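/- arXiv:2507.16394 — 2 statements merged into one kernel-verified Lean document; each statement's English description precedes it below -/
import Mathlib

section
/- Let n ≥ 2 and let Γ ⊆ ℝⁿ satisfy the standard cone conditions. Then there exists a unique real number μ ∈ [0, n−1] such that for every t ∈ ℝ, the vector (−t, 1, …, 1) belongs to Γ if and only if t < μ. Moreover, for t ∈ ℝ the vector (−t, 1, …, 1) belongs to the topological frontier ∂Γ of Γ if and only if t = μ. -/
/-- An open convex cone absorbs its closure under addition. -/
theorem Convex.add_mem_of_mem_closure_of_isOpen {E : Type*} [AddCommGroup E] [Module ℝ E]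
    [TopologicalSpace E] [IsTopologicalAddGroup E] [ContinuousConstSMul ℝ E] {s : Set E}
    (hconv : Convex ℝ s) (hopen : IsOpen s) (hcone : ∀ t : ℝ, 0 < t → ∀ x ∈ s, t • x ∈ s)
    {x y : E} (hx : x ∈ closure s) (hy : y ∈ s) : x + y ∈ s := by
  have h := hconv.combo_closure_interior_mem_interior hx (hopen.interior_eq.symm ▸ hy)
    (a := 1 / 2) (b := 1 / 2) (by norm_num) (by norm_num) (by norm_num)
  rw [hopen.interior_eq] at h
  have h2 := hcone 2 two_pos _ h
  rwa [← smul_add, smul_smul, show (2 : ℝ) * (1 / 2) = 1 by norm_num, one_smul] at h2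

/-- For a cone Γ satisfying the standard cone conditions, there is a unique
μ ∈ [0, n−1] such that (−t,1,…,1) ∈ Γ iff t < μ, and (−t,1,…,1) ∈ ∂Γ iff t = μ. -/
theorem stmt_0 (n : ℕ) (hn : 2 ≤ n) (Γ : Set (Fin n → ℝ))
    (hopen : IsOpen Γ) (hconv : Convex ℝ Γ)
    (hsymm : ∀ (σ : Equiv.Perm (Fin n)), ∀ x ∈ Γ, (x ∘ σ) ∈ Γ)
    (hcone : ∀ t : ℝ, 0 < t → ∀ x ∈ Γ, t • x ∈ Γ)
    (hsub : {x : Fin n → ℝ | ∀ i, 0 < x i} ⊆ Γ)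
    (hsup : Γ ⊆ {x : Fin n → ℝ | 0 < ∑ i, x i}) :
    ∃! μ : ℝ, μ ∈ Set.Icc (0 : ℝ) ((n : ℝ) - 1) ∧
      (∀ t : ℝ, ((fun i : Fin n => if (i : ℕ) = 0 then -t else 1) ∈ Γ ↔ t < μ)) ∧
      (∀ t : ℝ, ((fun i : Fin n => if (i : ℕ) = 0 then -t else 1) ∈ frontier Γ ↔ t = μ)) := by
  have hn0 : 0 < n := by lia
  set v : ℝ → Fin n → ℝ := fun t i => if (i : ℕ) = 0 then -t else 1 with hv
  have hvc : Continuous v := by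
    refine continuous_pi fun i => ?_
    by_cases hi : (i : ℕ) = 0 <;> simp only [hv, hi, if_true, if_false] <;> fun_prop
  have hneg : ∀ t < 0, v t ∈ Γ := fun t ht => hsub fun i => by
    simp only [hv]
    split_ifs <;> linarith
  have hsum : ∀ t, ∑ i, v t i = (n : ℝ) - 1 - t := by
    intro t
    obtain ⟨m, rfl⟩ : ∃ m, n = m + 1 := ⟨n - 1, by lia⟩
    simp [hv, Fin.sum_univ_succ]
    ring
  have hlt : ∀ t, v t ∈ Γ → t < (n : ℝ) - 1 := by
    intro t ht
    have h : 0 < ∑ i, v t i := hsup ht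
    rw [hsum] at h
    linarith
  have hdown : ∀ s t, s ≤ t → v t ∈ Γ → v s ∈ Γ := by
    intro s t hst ht
    have hS : Convex ℝ (v ⁻¹' Γ) := by
      intro a ha b hb p q hp hq hpq
      have h := hconv ha hb hp hq hpq
      have he : v (p • a + q • b) = p • v a + q • v b := by
        ext i
        simp only [hv, Pi.add_apply, Pi.smul_apply, smul_eq_mul]
        split_ifs <;> linarith
      rwa [Set.mem_preimage, he]
    have hm : min s (-1) ∈ v ⁻¹' Γ := hneg _ (by simp)
    exact hS.ordConnected.out hm ht ⟨min_le_left _ _, hst⟩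
  have hSopen : IsOpen (v ⁻¹' Γ) := hopen.preimage hvc
  have hbdd : BddAbove (v ⁻¹' Γ) := ⟨(n : ℝ) - 1, fun t ht => (hlt t ht).le⟩
  have hne : (v ⁻¹' Γ).Nonempty := ⟨-1, hneg _ (by norm_num)⟩
  set μ := sSup (v ⁻¹' Γ) with hμ
  have hμ0 : 0 ≤ μ := le_of_forall_lt fun t ht => by
    have h := le_csSup hbdd (show t / 2 ∈ v ⁻¹' Γ from hneg _ (by linarith))
    linarith
  have hμn : μ ≤ (n : ℝ) - 1 := csSup_le hne fun t ht => (hlt t ht).le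
  have hμmem : v μ ∉ Γ := by
    intro h
    obtain ⟨u, hu, hsu⟩ := exists_Ico_subset_of_mem_nhds (hSopen.mem_nhds h) (exists_gt μ)
    have := le_csSup hbdd (hsu (⟨by linarith, by linarith⟩ : (μ + u) / 2 ∈ Set.Ico μ u))
    linarith
  have hmem : ∀ t, v t ∈ Γ ↔ t < μ := by
    refine fun t => ⟨fun h => ?_, fun h => ?_⟩
    · by_contra! hle
      exact hμmem (hdown _ _ hle h)
    · obtain ⟨s, hs, hts⟩ := exists_lt_of_lt_csSup hne h
      exact hdown _ _ hts.le hs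
  have hfr : ∀ t, v t ∈ frontier Γ ↔ t = μ := by
    intro t
    rw [hopen.frontier_eq, Set.mem_sdiff, hmem, not_lt]
    refine ⟨fun ⟨hc, hle⟩ => ?_, ?_⟩
    · by_contra hne'
      have hgt : μ < t := lt_of_le_of_ne hle (Ne.symm hne')
      have h1μ : 0 < 1 + μ := by linarith
      set ε := (t - μ) / (1 + μ) with hε
      have hεpos : 0 < ε := div_pos (by linarith) h1μ
      have hεmul : ε * (1 + μ) = t - μ := div_mul_cancel₀ _ h1μ.ne'
      have h := hconv.add_mem_of_mem_closure_of_isOpen hopen hcone hc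
        (hsub (fun _ => hεpos : ∀ i : Fin n, 0 < (fun _ => ε : Fin n → ℝ) i))
      have h' := hcone (1 + ε)⁻¹ (by positivity) _ h
      have he : (1 + ε)⁻¹ • (v t + fun _ => ε) = v μ := by
        rw [inv_smul_eq_iff₀ (by positivity)]
        ext i
        simp only [hv, Pi.add_apply, Pi.smul_apply, smul_eq_mul]
        split_ifs <;> linarith
      exact hμmem (he ▸ h')
    · rintro rfl
      refine ⟨?_, le_rfl⟩
      have hcl : μ ∈ closure (Set.Iio μ) := by simp
      exact map_mem_closure hvc hcl fun s hs => (hmem s).2 hs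
  exact ⟨μ, ⟨⟨hμ0, hμn⟩, hmem, hfr⟩, fun μ' h => (hfr μ').1 ((h.2.2 μ').2 rfl)⟩
end

section
/- Let n ≥ 2, 1 ≤ k ≤ n and μ ∈ ℝ. Then the vector (−μ, 1, …, 1) ∈ ℝⁿ belongs to the Gårding cone Γ_k⁺ if and only if μ < (n−k)/k. In particular, the constant μ⁺ associated to Γ_k⁺ (the unique μ with (−μ,1,…,1) ∈ ∂Γ_k⁺) equals (n−k)/k. -/
/-- The k-th elementary symmetric polynomial of x ∈ ℝⁿ. -/
noncomputable def esymm (n k : ℕ) (x : Fin n → ℝ) : ℝ :=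
  ∑ s ∈ Finset.powersetCard k Finset.univ, ∏ i ∈ s, x i

/-- The Gårding cone Γ_k⁺ = {λ ∈ ℝⁿ : σ_j(λ) > 0 for 1 ≤ j ≤ k}. -/
def gardingCone (n k : ℕ) : Set (Fin n → ℝ) :=
  {x | ∀ j : ℕ, 1 ≤ j → j ≤ k → 0 < esymm n j x}

theorem continuous_esymm (n k : ℕ) : Continuous (esymm n k) := by
  unfold esymm
  fun_prop

theorem isOpen_gardingCone (n k : ℕ) : IsOpen (gardingCone n k) := by
  have h : gardingCone n k = ⋂ j ∈ Finset.Icc 1 k, {x | 0 < esymm n j x} := by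
    ext x
    simp [gardingCone]
  rw [h]
  exact isOpen_biInter_finset fun j _ => isOpen_lt continuous_const (continuous_esymm n j)

theorem esymm_ite_zero (m j : ℕ) (a : ℝ) :
    esymm (m + 1) (j + 1) (fun i => if (i : ℕ) = 0 then a else 1) =
      m.choose (j + 1) + m.choose j * a := by
  have hprod (s : Finset (Fin (m + 1))) :
      ∏ i ∈ s, (if (i : ℕ) = 0 then a else 1) = if 0 ∈ s then a else 1 := by
    simp_rw [Fin.val_eq_zero_iff]
    exact Finset.prod_ite_eq' s 0 fun _ => a
  have h0 : (0 : Fin (m + 1)) ∉ Finset.univ.erase 0 := Finset.notMem_erase _ _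
  have hmem {r : ℕ} {s : Finset (Fin (m + 1))}
      (hs : s ∈ Finset.powersetCard r (Finset.univ.erase 0)) : 0 ∉ s :=
    fun h => h0 ((Finset.mem_powersetCard.1 hs).1 h)
  unfold esymm
  simp_rw [hprod]
  rw [← Finset.insert_erase (Finset.mem_univ (0 : Fin (m + 1))),
    Finset.powersetCard_succ_insert h0, Finset.sum_union, Finset.sum_image]
  · congr 1
    · rw [Finset.sum_congr rfl fun s hs => if_neg (hmem hs)]
      simp
    · simp
  · intro s hs t ht hst
    rw [← Finset.erase_insert (hmem hs), ← Finset.erase_insert (hmem ht), hst]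
  · rw [Finset.disjoint_left]
    intro s hs hs'
    obtain ⟨t, -, rfl⟩ := Finset.mem_image.1 hs'
    exact hmem hs (Finset.mem_insert_self _ _)

theorem mul_esymm_ite_zero {n j : ℕ} (hj : 1 ≤ j) (hjn : j ≤ n) (μ : ℝ) :
    j * esymm n j (fun i => if (i : ℕ) = 0 then -μ else 1) =
      (n - 1).choose (j - 1) * ((n - j) - j * μ) := by
  obtain ⟨m, rfl⟩ : ∃ m, n = m + 1 := ⟨n - 1, by omega⟩
  obtain ⟨l, rfl⟩ : ∃ l, j = l + 1 := ⟨j - 1, by omega⟩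
  have h : (m.choose (l + 1) : ℝ) * (l + 1) = m.choose l * (m - l) := by
    rw [← Nat.cast_sub (by omega : l ≤ m)]
    exact_mod_cast Nat.choose_succ_right_eq m l
  rw [esymm_ite_zero]
  simp only [Nat.add_sub_cancel]
  push_cast
  linear_combination h

theorem esymm_ite_zero_pos_iff {n j : ℕ} (hj : 1 ≤ j) (hjn : j ≤ n) (μ : ℝ) :
    0 < esymm n j (fun i => if (i : ℕ) = 0 then -μ else 1) ↔ μ < ((n : ℝ) - j) / j := by
  have hj0 : (0 : ℝ) < j := by exact_mod_cast hj
  have hc : (0 : ℝ) < (n - 1).choose (j - 1) := by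
    exact_mod_cast Nat.choose_pos (by omega)
  rw [← mul_pos_iff_of_pos_left hj0, mul_esymm_ite_zero hj hjn, mul_pos_iff_of_pos_left hc,
    sub_pos, lt_div_iff₀' hj0]

theorem esymm_ite_zero_nonneg_iff {n j : ℕ} (hj : 1 ≤ j) (hjn : j ≤ n) (μ : ℝ) :
    0 ≤ esymm n j (fun i => if (i : ℕ) = 0 then -μ else 1) ↔ μ ≤ ((n : ℝ) - j) / j := by
  have hj0 : (0 : ℝ) < j := by exact_mod_cast hj
  have hc : (0 : ℝ) < (n - 1).choose (j - 1) := by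
    exact_mod_cast Nat.choose_pos (by omega)
  rw [← mul_nonneg_iff_of_pos_left hj0, mul_esymm_ite_zero hj hjn,
    mul_nonneg_iff_of_pos_left hc, sub_nonneg, le_div_iff₀' hj0]

theorem ite_zero_mem_gardingCone_iff {n k : ℕ} (hk : 1 ≤ k) (hkn : k ≤ n) (μ : ℝ) :
    (fun i : Fin n => if (i : ℕ) = 0 then -μ else 1) ∈ gardingCone n k ↔
      μ < ((n : ℝ) - k) / k := by
  refine ⟨fun h => (esymm_ite_zero_pos_iff hk hkn μ).1 (h k hk le_rfl), fun h j hj hjk => ?_⟩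
  refine (esymm_ite_zero_pos_iff hj (hjk.trans hkn) μ).2 (h.trans_le ?_)
  have hj0 : (0 : ℝ) < j := by exact_mod_cast hj
  have hjk' : (j : ℝ) ≤ k := by exact_mod_cast hjk
  have hkn' : (k : ℝ) ≤ n := by exact_mod_cast hkn
  exact div_le_div₀ (by linarith) (by linarith) hj0 hjk'

theorem ite_zero_mem_closure_gardingCone_iff {n k : ℕ} (hk : 1 ≤ k) (hkn : k ≤ n) (μ : ℝ) :
    (fun i : Fin n => if (i : ℕ) = 0 then -μ else 1) ∈ closure (gardingCone n k) ↔
      μ ≤ ((n : ℝ) - k) / k := by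
  constructor
  · intro h
    have hsub : gardingCone n k ⊆ {x | 0 ≤ esymm n k x} := fun x hx => (hx k hk le_rfl).le
    exact (esymm_ite_zero_nonneg_iff hk hkn μ).1
      (closure_minimal hsub (isClosed_le continuous_const (continuous_esymm n k)) h)
  · intro h
    have hcont : Continuous fun (ν : ℝ) (i : Fin n) => if (i : ℕ) = 0 then -ν else 1 := by
      refine continuous_pi fun i => ?_
      split_ifs <;> fun_prop
    refine map_mem_closure (s := Set.Iio (((n : ℝ) - k) / k)) hcont ?_
      fun ν hν => (ite_zero_mem_gardingCone_iff hk hkn ν).2 hν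
    rwa [closure_Iio, Set.mem_Iic]

/-- (−μ,1,…,1) ∈ Γ_k⁺ iff μ < (n−k)/k, and (−μ,1,…,1) ∈ ∂Γ_k⁺ iff
μ = (n−k)/k, i.e. μ⁺(Γ_k⁺) = (n−k)/k. -/
theorem stmt_4 (n k : ℕ) (hn : 2 ≤ n) (hk1 : 1 ≤ k) (hkn : k ≤ n) :
    (∀ μ : ℝ, ((fun i : Fin n => if (i : ℕ) = 0 then -μ else 1) ∈ gardingCone n k ↔
      μ < ((n : ℝ) - (k : ℝ)) / (k : ℝ))) ∧
    (∀ μ : ℝ, ((fun i : Fin n => if (i : ℕ) = 0 then -μ else 1) ∈ frontier (gardingCone n k) ↔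
      μ = ((n : ℝ) - (k : ℝ)) / (k : ℝ))) := by
  refine ⟨ite_zero_mem_gardingCone_iff hk1 hkn, fun μ => ?_⟩
  rw [(isOpen_gardingCone n k).frontier_eq, Set.mem_sdiff,
    ite_zero_mem_closure_gardingCone_iff hk1 hkn, ite_zero_mem_gardingCone_iff hk1 hkn, not_lt]
  exact le_antisymm_iff.symm
end
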